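/- Convergence (Corollary 1, deterministic sample-path form). Under all assumptions listed in the context, the iterates converge to a bounded invariant set of the ODE ẋ(t) = h(x(t)): there exists a nonempty bounded set X ⊆ ℝ^d such that (i) for every x ∈ X there exists a solution z : ℝ → ℝ^d of ż(t) = h(z(t)) with z(0) = x and z(t) ∈ X for all t ∈ ℝ, and (ii) lim_{n→∞} inf_{x ∈ X} ‖x_n − x‖ = 0. -/

import Mathlib

open Filter

section ODE

variable {E : Type*} [NormedAddCommGroup E] [NormedSpace ℝ E]

theorem eqOn_Ioo_of_hasDerivAt_of_lipschitz {f : E → E} {K : NNReal} (hf : LipschitzWith K f)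
    {z w : ℝ → E} {a b s₀ : ℝ} (hs₀ : s₀ ∈ Set.Ioo a b)
    (hz : ∀ s ∈ Set.Ioo a b, HasDerivAt z (f (z s)) s)
    (hw : ∀ s ∈ Set.Ioo a b, HasDerivAt w (f (w s)) s) (heq : z s₀ = w s₀) :
    Set.EqOn z w (Set.Ioo a b) :=
  ODE_solution_unique_of_mem_Ioo (v := fun _ => f) (s := fun _ => Set.univ) (K := K)
    (fun _ _ => hf.lipschitzOnWith) hs₀ (fun s hs => ⟨hz s hs, trivial⟩)
    (fun s hs => ⟨hw s hs, trivial⟩) heq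

theorem hasDerivAt_of_eqOn_Ioo {f : E → E} {z w : ℝ → E} {a b s : ℝ}
    (hs : s ∈ Set.Ioo a b) (hw : HasDerivAt w (f (w s)) s) (heq : Set.EqOn z w (Set.Ioo a b)) :
    HasDerivAt z (f (z s)) s := by
  rw [heq hs]
  exact hw.congr_of_eventuallyEq (heq.eventuallyEq_of_mem (Ioo_mem_nhds hs.1 hs.2))

theorem exists_solution_Ioo_of_lipschitz [CompleteSpace E] {f : E → E} {K : NNReal}
    (hf : LipschitzWith K f) :
    ∃ τ : ℝ, 0 < τ ∧ ∀ p : E, ∃ z : ℝ → E, z 0 = p ∧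
      ∀ s ∈ Set.Ioo (-τ) τ, HasDerivAt z (f (z s)) s := by
  refine ⟨1 / (K + 1), by positivity, fun p => ?_⟩
  have hK : (0 : ℝ) < K + 1 := by positivity
  have hpl : IsPicardLindelof (fun _ => f) (tmin := -(1 / (K + 1) : ℝ)) (tmax := 1 / (K + 1))
      ⟨0, by constructor <;> simp <;> positivity⟩ p (‖f p‖₊) 0 ((K + 1) * ‖f p‖₊) K := by
    refine IsPicardLindelof.of_time_independent (fun y hy => ?_) hf.lipschitzOnWith ?_
    · have h1 := hf.norm_sub_le y p
      have h2 : ‖f y‖ ≤ ‖f y - f p‖ + ‖f p‖ := norm_le_norm_sub_add _ _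
      rw [mem_closedBall_iff_norm] at hy
      have h3 : (K : ℝ) * ‖y - p‖ ≤ K * ‖f p‖ := by
        have : ‖y - p‖ ≤ ‖f p‖ := by simpa using hy
        gcongr
      push_cast
      linarith
    · push_cast
      simp
      field_simp
      simp
  obtain ⟨z, hz0, hz⟩ := hpl.exists_eq_forall_mem_Icc_hasDerivWithinAt₀
  exact ⟨z, hz0, fun s hs => (hz s (Set.Ioo_subset_Icc_self hs)).hasDerivAt
    (Icc_mem_nhds hs.1 hs.2)⟩

theorem exists_solution_Ioo_extend {f : E → E} {K : NNReal}
    (hf : LipschitzWith K f) {τ : ℝ} (hτ : 0 < τ)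
    (hsol : ∀ p : E, ∃ z : ℝ → E, z 0 = p ∧
      ∀ s ∈ Set.Ioo (-(2 * τ)) (2 * τ), HasDerivAt z (f (z s)) s) (p : E) :
    ∃ z : ℝ → E, z 0 = p ∧
      ∀ s ∈ Set.Ioo (-(3 * τ)) (3 * τ), HasDerivAt z (f (z s)) s := by
  obtain ⟨z, hz0, hz⟩ := hsol p
  obtain ⟨u, hu0, hu⟩ := hsol (z τ)
  obtain ⟨v, hv0, hv⟩ := hsol (z (-τ))
  have hu' : ∀ s ∈ Set.Ioo (-τ) (3 * τ),
      HasDerivAt (fun s => u (s - τ)) (f (u (s - τ))) s := fun s hs =>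
    (hu (s - τ) ⟨by linarith [hs.1], by linarith [hs.2]⟩).comp_sub_const s τ
  have hv' : ∀ s ∈ Set.Ioo (-(3 * τ)) τ,
      HasDerivAt (fun s => v (s + τ)) (f (v (s + τ))) s := fun s hs =>
    (hv (s + τ) ⟨by linarith [hs.1], by linarith [hs.2]⟩).comp_add_const s τ
  have hzu : Set.EqOn z (fun s => u (s - τ)) (Set.Ioo (-τ) (2 * τ)) :=
    eqOn_Ioo_of_hasDerivAt_of_lipschitz hf (s₀ := τ) ⟨by linarith, by linarith⟩
      (fun s hs => hz s ⟨by linarith [hs.1], hs.2⟩)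
      (fun s hs => hu' s ⟨hs.1, by linarith [hs.2]⟩) (by simp [hu0])
  have hzv : Set.EqOn z (fun s => v (s + τ)) (Set.Ioo (-(2 * τ)) τ) :=
    eqOn_Ioo_of_hasDerivAt_of_lipschitz hf (s₀ := -τ) ⟨by linarith, by linarith⟩
      (fun s hs => hz s ⟨hs.1, by linarith [hs.2]⟩)
      (fun s hs => hv' s ⟨by linarith [hs.1], hs.2⟩) (by simp [hv0])
  refine ⟨fun s => if s < 0 then v (s + τ) else u (s - τ), ?_, fun s hs => ?_⟩
  · simpa [hz0] using (hzu (x := 0) ⟨by linarith, by linarith⟩).symm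
  · rcases lt_or_ge s τ with hsτ | hsτ
    · refine hasDerivAt_of_eqOn_Ioo ⟨hs.1, hsτ⟩ (hv' s ⟨hs.1, hsτ⟩) fun r hr => ?_
      by_cases hr0 : r < 0
      · simp [hr0]
      · simp only [hr0, if_false]
        exact (hzu ⟨by linarith, by linarith [hr.2]⟩).symm.trans
          (hzv ⟨by linarith, hr.2⟩)
    · refine hasDerivAt_of_eqOn_Ioo (a := -τ) ⟨by linarith, hs.2⟩
        (hu' s ⟨by linarith, hs.2⟩) fun r hr => ?_
      by_cases hr0 : r < 0
      · simp only [hr0, if_true]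
        exact (hzv ⟨by linarith [hr.1], by linarith⟩).symm.trans
          (hzu ⟨hr.1, by linarith⟩)
      · simp [hr0]

theorem exists_global_solution_of_lipschitz [CompleteSpace E] {f : E → E} {K : NNReal}
    (hf : LipschitzWith K f) (p : E) :
    ∃ z : ℝ → E, z 0 = p ∧ ∀ s, HasDerivAt z (f (z s)) s := by
  obtain ⟨τ, hτ, hloc⟩ := exists_solution_Ioo_of_lipschitz hf
  have hall : ∀ n : ℕ, ∀ p : E, ∃ z : ℝ → E, z 0 = p ∧
      ∀ s ∈ Set.Ioo (-(τ * (3 / 2) ^ n)) (τ * (3 / 2) ^ n), HasDerivAt z (f (z s)) s := by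
    intro n
    induction n with
    | zero => simpa using hloc
    | succ n ih =>
      have h2 : 2 * (τ * (3 / 2) ^ n / 2) = τ * (3 / 2) ^ n := by ring
      have h3 : 3 * (τ * (3 / 2) ^ n / 2) = τ * (3 / 2) ^ (n + 1) := by ring
      rw [← h3]
      exact exists_solution_Ioo_extend hf (by positivity) (by rwa [h2])
  choose z hz0 hz using fun n => hall n p
  have hbig : ∀ s : ℝ, ∃ n : ℕ, |s| < τ * (3 / 2) ^ n := fun s => by
    obtain ⟨n, hn⟩ := pow_unbounded_of_one_lt (|s| / τ) (by norm_num : (1 : ℝ) < 3 / 2)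
    exact ⟨n, by rwa [div_lt_iff₀' hτ] at hn⟩
  choose N hN using hbig
  have hagree : ∀ n k : ℕ, ∀ s, |s| < τ * (3 / 2) ^ n → |s| < τ * (3 / 2) ^ k →
      z n s = z k s := by
    intro n k s hn hk
    have hmin := lt_min hn hk
    have hpos := (abs_nonneg s).trans_lt hmin
    refine eqOn_Ioo_of_hasDerivAt_of_lipschitz hf (s₀ := 0)
      (a := -min (τ * (3 / 2) ^ n) (τ * (3 / 2) ^ k))
      (b := min (τ * (3 / 2) ^ n) (τ * (3 / 2) ^ k)) ⟨by linarith, hpos⟩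
      (fun r hr => hz n r ?_) (fun r hr => hz k r ?_) (by rw [hz0, hz0]) (abs_lt.1 hmin)
    · exact ⟨by linarith [hr.1, min_le_left (τ * (3 / 2) ^ n) (τ * (3 / 2) ^ k)],
        hr.2.trans_le (min_le_left _ _)⟩
    · exact ⟨by linarith [hr.1, min_le_right (τ * (3 / 2) ^ n) (τ * (3 / 2) ^ k)],
        hr.2.trans_le (min_le_right _ _)⟩
  refine ⟨fun s => z (N s) s, hz0 _, fun s => ?_⟩
  exact hasDerivAt_of_eqOn_Ioo (abs_lt.1 (hN s)) (hz (N s) s (abs_lt.1 (hN s)))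
    fun r hr => hagree _ _ r (hN r) (abs_lt.2 hr)

theorem integral_eq_of_hasDerivAt {f : E → E} [CompleteSpace E] (hf : Continuous f) {z : ℝ → E}
    (hz : ∀ s, HasDerivAt z (f (z s)) s) (s : ℝ) :
    z s = z 0 + ∫ u in (0 : ℝ)..s, f (z u) := by
  have hcont : Continuous z := continuous_iff_continuousAt.2 fun s => (hz s).continuousAt
  rw [intervalIntegral.integral_eq_sub_of_hasDerivAt (fun u _ => hz u)
    ((hf.comp hcont).intervalIntegrable _ _)]
  abel

theorem dist_solutions_le {f : E → E} {K : NNReal} (hf : LipschitzWith K f) {z w : ℝ → E}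
    (hz : ∀ s, HasDerivAt z (f (z s)) s) (hw : ∀ s, HasDerivAt w (f (w s)) s) (a b : ℝ) :
    ‖z b - w b‖ ≤ ‖z a - w a‖ * Real.exp (K * |b - a|) := by
  have hforward : ∀ {g : E → E}, LipschitzWith K g → ∀ {u v : ℝ → E},
      (∀ s, HasDerivAt u (g (u s)) s) → (∀ s, HasDerivAt v (g (v s)) s) → ∀ a b : ℝ, a ≤ b →
      ‖u b - v b‖ ≤ ‖u a - v a‖ * Real.exp (K * (b - a)) := by
    intro g hg u v hu hv a b hab
    have := dist_le_of_trajectories_ODE (v := fun _ => g) (fun _ => hg)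
      (a := a) (b := b) (f := u) (g := v)
      (fun s _ => (hu s).continuousAt.continuousWithinAt) (fun s _ => (hu s).hasDerivWithinAt)
      (fun s _ => (hv s).continuousAt.continuousWithinAt) (fun s _ => (hv s).hasDerivWithinAt)
      le_rfl b ⟨hab, le_rfl⟩
    simpa [dist_eq_norm] using this
  rcases le_total a b with hab | hab
  · rw [abs_of_nonneg (by linarith)]
    exact hforward hf hz hw a b hab
  · have hrev : ∀ {u : ℝ → E}, (∀ s, HasDerivAt u (f (u s)) s) →
        ∀ s, HasDerivAt (fun s => u (-s)) ((-f) (u (-s))) s := fun {u} hu s => by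
      simpa [Function.comp_def] using (hu (-s)).scomp s (hasDerivAt_neg s)
    have := hforward hf.neg (hrev hz) (hrev hw) (-a) (-b) (by linarith)
    rw [abs_of_nonpos (by linarith)]
    simp only [neg_neg] at this
    rwa [show -(b - a) = -b - -a by ring]

theorem exists_bounds_of_solution {g : E → E} {K : NNReal} (hg : LipschitzWith K g) (T R : ℝ) :
    ∃ B M : ℝ, 0 ≤ M ∧ ∀ w : ℝ → E, (∀ s, HasDerivAt w (g (w s)) s) → ‖w 0‖ ≤ R →
      (∀ s ∈ Set.Icc 0 T, ‖w s‖ ≤ B) ∧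
      (∀ r ∈ Set.Icc 0 T, ∀ s ∈ Set.Icc 0 T, ‖w s - w r‖ ≤ M * |s - r|) := by
  have hgrow : ∀ p, ‖g p‖ ≤ K * ‖p‖ + ‖g 0‖ := fun p => by
    have h1 := hg.norm_sub_le p 0
    have h2 : ‖g p‖ ≤ ‖g p - g 0‖ + ‖g 0‖ := norm_le_norm_sub_add _ _
    rw [sub_zero] at h1
    linarith
  refine ⟨gronwallBound (max R 0) K ‖g 0‖ T,
    max 0 (K * gronwallBound (max R 0) K ‖g 0‖ T + ‖g 0‖), le_max_left _ _,
    fun w hw hR => ?_⟩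
  have hbound : ∀ s ∈ Set.Icc 0 T, ‖w s‖ ≤ gronwallBound (max R 0) K ‖g 0‖ T := fun s hs =>
    (norm_le_gronwallBound_of_norm_deriv_right_le (f := w) (f' := fun s => g (w s))
      (fun s _ => (hw s).continuousAt.continuousWithinAt) (fun s _ => (hw s).hasDerivWithinAt)
      (hR.trans (le_max_left _ _)) (fun s _ => hgrow (w s)) s hs).trans
      (gronwallBound_mono (le_max_right _ _) (norm_nonneg _) K.2 (by linarith [hs.2]))
  refine ⟨hbound, fun r hr s hs => ?_⟩
  refine (convex_Icc (0 : ℝ) T).norm_image_sub_le_of_norm_hasDerivWithin_le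
    (f := w) (f' := fun s => g (w s)) (fun s _ => (hw s).hasDerivWithinAt) (fun s hs => ?_) hr hs
  refine le_max_of_le_right ((hgrow _).trans ?_)
  have := hbound s hs
  gcongr

theorem norm_solution_sub_euler_step_le {g : E → E} {K : NNReal} (hg : LipschitzWith K g)
    {w : ℝ → E} (hw : ∀ s, HasDerivAt w (g (w s)) s) {M r s : ℝ} (hM : 0 ≤ M) (hrs : r ≤ s)
    (hlip : ∀ u ∈ Set.Icc r s, ‖w u - w r‖ ≤ M * |u - r|) :
    ‖w s - w r - (s - r) • g (w r)‖ ≤ K * M * (s - r) ^ 2 := by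
  have hderiv : ∀ u ∈ Set.Icc r s,
      HasDerivWithinAt (fun u => w u - u • g (w r)) (g (w u) - (1 : ℝ) • g (w r))
        (Set.Icc r s) u := fun u _ =>
    ((hw u).sub ((hasDerivAt_id u).smul_const (g (w r)))).hasDerivWithinAt
  have hbound : ∀ u ∈ Set.Icc r s, ‖g (w u) - (1 : ℝ) • g (w r)‖ ≤ K * M * (s - r) :=
    fun u hu => by
      rw [one_smul]
      refine (hg.norm_sub_le _ _).trans ?_
      have h1 := hlip u hu
      rw [abs_of_nonneg (by linarith [hu.1])] at h1
      have h2 : M * (u - r) ≤ M * (s - r) :=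
        mul_le_mul_of_nonneg_left (by linarith [hu.2]) hM
      rw [mul_assoc]
      exact mul_le_mul_of_nonneg_left (h1.trans h2) K.2
  have := (convex_Icc r s).norm_image_sub_le_of_norm_hasDerivWithin_le hderiv hbound
    (Set.left_mem_Icc.2 hrs) (Set.right_mem_Icc.2 hrs)
  rw [Real.norm_of_nonneg (by linarith)] at this
  calc ‖w s - w r - (s - r) • g (w r)‖
      = ‖w s - s • g (w r) - (w r - r • g (w r))‖ := by congr 1; module
    _ ≤ K * M * (s - r) * (s - r) := this
    _ = K * M * (s - r) ^ 2 := by ring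

end ODE

section Averaging

variable {E : Type*} [NormedAddCommGroup E] [NormedSpace ℝ E]

/-- Uniformly in the parameter `c` along `l`, the sums of `α i • (F c i - v)` over index windows
of bounded length in the time scale `t` vanish as the window moves to infinity. -/
def AveragesTo (α t : ℕ → ℝ) (l : Filter ℝ) (F : ℝ → ℕ → E) (v : E) : Prop :=
  ∀ τ > 0, ∀ ε > 0, ∀ᶠ N in atTop, ∀ᶠ c in l, ∀ n ≥ N, ∀ k ≥ n, t k - t n ≤ τ →
    ‖∑ i ∈ Finset.Ico n k, α i • (F c i - v)‖ ≤ ε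

variable {α t : ℕ → ℝ}

theorem sum_Ico_step (ht : ∀ i, t (i + 1) = t i + α i) {n k : ℕ} (hnk : n ≤ k) :
    ∑ i ∈ Finset.Ico n k, α i = t k - t n := by
  rw [← Finset.sum_Ico_sub t hnk]
  exact Finset.sum_congr rfl fun i _ => by rw [ht]; ring

theorem monotone_of_step (ht : ∀ i, t (i + 1) = t i + α i) (hα : ∀ i, 0 < α i) : Monotone t :=
  monotone_nat_of_le_succ fun i => by rw [ht]; linarith [hα i]

theorem sum_mul_le_of_norm_sum_smul_sub_le (ht : ∀ i, t (i + 1) = t i + α i) {ℓ : ℕ → ℝ}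
    {K ε : ℝ} {n k : ℕ} (hnk : n ≤ k)
    (h : ‖∑ i ∈ Finset.Ico n k, α i • (ℓ i - K)‖ ≤ ε) :
    ∑ i ∈ Finset.Ico n k, α i * ℓ i ≤ K * (t k - t n) + ε := by
  have h1 := (le_abs_self _).trans h
  simp only [smul_eq_mul, mul_sub, Finset.sum_sub_distrib] at h1
  rw [← Finset.sum_mul, sum_Ico_step ht hnk] at h1
  linarith

theorem norm_sum_sub_le_of_near (ht : ∀ i, t (i + 1) = t i + α i) (hα : ∀ i, 0 < α i)
    {F : ℕ → E → E} {g : E → E} {ℓ : ℕ → ℝ} {K : NNReal}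
    (hF : ∀ i p q, ‖F i p - F i q‖ ≤ ℓ i * ‖p - q‖) (hℓ : ∀ i, 0 ≤ ℓ i) (hg : LipschitzWith K g)
    {n k : ℕ} (hnk : n ≤ k) {w : ℕ → E} {p : E} {r : ℝ}
    (hw : ∀ i ∈ Finset.Ico n k, ‖w i - p‖ ≤ r) :
    ‖∑ i ∈ Finset.Ico n k, α i • (F i (w i) - g (w i))‖ ≤
      ‖∑ i ∈ Finset.Ico n k, α i • (F i p - g p)‖ +
        (∑ i ∈ Finset.Ico n k, α i * ℓ i + K * (t k - t n)) * r := by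
  have hsplit : ∑ i ∈ Finset.Ico n k, α i • (F i (w i) - g (w i)) =
      ∑ i ∈ Finset.Ico n k, α i • (F i p - g p) +
      ∑ i ∈ Finset.Ico n k, α i • ((F i (w i) - F i p) - (g (w i) - g p)) := by
    rw [← Finset.sum_add_distrib]
    exact Finset.sum_congr rfl fun i _ => by module
  rw [hsplit]
  refine (norm_add_le _ _).trans (add_le_add le_rfl ?_)
  rw [← sum_Ico_step ht hnk, Finset.mul_sum, ← Finset.sum_add_distrib, Finset.sum_mul]
  refine norm_sum_le_of_le _ fun i hi => ?_
  rw [norm_smul, Real.norm_of_nonneg (hα i).le]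
  have h1 : ‖F i (w i) - F i p‖ ≤ ℓ i * r :=
    (hF i _ _).trans (mul_le_mul_of_nonneg_left (hw i hi) (hℓ i))
  have h2 : ‖g (w i) - g p‖ ≤ K * r :=
    (hg.norm_sub_le _ _).trans (mul_le_mul_of_nonneg_left (hw i hi) K.2)
  calc α i * ‖F i (w i) - F i p - (g (w i) - g p)‖
      ≤ α i * (ℓ i * r + K * r) :=
        mul_le_mul_of_nonneg_left ((norm_sub_le _ _).trans (add_le_add h1 h2)) (hα i).le
    _ = (α i * ℓ i + K * α i) * r := by ring

theorem averages_uniformly_on_compact (ht : ∀ i, t (i + 1) = t i + α i) (hα : ∀ i, 0 < α i)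
    {l : Filter ℝ} {F : ℝ → ℕ → E → E} {g : E → E} {ℓ : ℕ → ℝ} {K : NNReal}
    (hF : ∀ c i p q, ‖F c i p - F c i q‖ ≤ ℓ i * ‖p - q‖) (hℓ : ∀ i, 0 ≤ ℓ i)
    (hg : LipschitzWith K g) (hℓavg : AveragesTo α t l (fun _ => ℓ) (K : ℝ))
    (havg : ∀ p, AveragesTo α t l (fun c i => F c i p) (g p))
    {S : Set E} (hS : IsCompact S) {τ ε : ℝ} (hτ : 0 < τ) (hε : 0 < ε) :
    ∀ᶠ N in atTop, ∀ᶠ c in l, ∀ p ∈ S, ∀ n ≥ N, ∀ k ≥ n, t k - t n ≤ τ →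
      ‖∑ i ∈ Finset.Ico n k, α i • (F c i p - g p)‖ ≤ ε := by
  refine hS.induction_on (p := fun S => ∀ᶠ N in atTop, ∀ᶠ c in l, ∀ p ∈ S, ∀ n ≥ N, ∀ k ≥ n,
    t k - t n ≤ τ → ‖∑ i ∈ Finset.Ico n k, α i • (F c i p - g p)‖ ≤ ε) (by simp) ?_ ?_ ?_
  · intro s u hsu hu
    filter_upwards [hu] with N hN
    filter_upwards [hN] with c hc p hp using hc p (hsu hp)
  · intro s u hs hu
    filter_upwards [hs, hu] with N hN hN'
    filter_upwards [hN, hN'] with c hc hc' p hp using hp.elim (hc p) (hc' p)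
  · intro p _
    have hB : 0 < 2 * (K * τ) + 1 := by positivity
    refine ⟨Metric.closedBall p (ε / 2 / (2 * (K * τ) + 1)),
      mem_nhdsWithin_of_mem_nhds (Metric.closedBall_mem_nhds _ (by positivity)), ?_⟩
    filter_upwards [havg p τ hτ (ε / 2) (by positivity), hℓavg τ hτ 1 one_pos] with N hN hN'
    filter_upwards [hN, hN'] with c hc hc' q hq n hn k hk hnk
    have hsum := sum_mul_le_of_norm_sum_smul_sub_le ht hk (hc' n hn k hk hnk)
    have h1 := hc n hn k hk hnk
    have h2 : (K : ℝ) * (t k - t n) ≤ K * τ := mul_le_mul_of_nonneg_left hnk K.2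
    refine (norm_sum_sub_le_of_near ht hα (hF c) hℓ hg hk (w := fun _ => q) (p := p)
      (fun i _ => mem_closedBall_iff_norm.1 hq)).trans ?_
    calc _ ≤ ε / 2 + (2 * (K * τ) + 1) * (ε / 2 / (2 * (K * τ) + 1)) :=
          add_le_add h1 (mul_le_mul_of_nonneg_right (by linarith) (by positivity))
      _ = ε := by field_simp; ring

theorem norm_sub_le_of_blocks (ht : ∀ i, t (i + 1) = t i + α i) (hα : ∀ i, 0 < α i)
    {V : Type*} [SeminormedAddCommGroup V] {S : ℕ → V} {δ ν : ℝ} {n k₀ : ℕ}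
    (hδ : 0 < δ) (hν : 0 ≤ ν) (hαδ : ∀ i ≥ n, α i ≤ δ)
    (hblock : ∀ j k, n ≤ j → j ≤ k → k ≤ k₀ → t k - t j ≤ 2 * δ → ‖S k - S j‖ ≤ ν)
    {k : ℕ} (hnk : n ≤ k) (hk : k ≤ k₀) :
    ‖S k - S n‖ ≤ ((t k - t n) / δ + 1) * ν := by
  have hmono := monotone_of_step ht hα
  have key : ∃ j, n ≤ j ∧ j ≤ k ∧ t k - t j ≤ 2 * δ ∧ ‖S j - S n‖ ≤ (t j - t n) / δ * ν := by
    induction k, hnk using Nat.le_induction with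
    | base => exact ⟨n, le_rfl, le_rfl, by simp [hδ.le], by simp⟩
    | succ k hnk ih =>
      obtain ⟨j, hnj, hjk, htj, hSj⟩ := ih (by omega)
      by_cases hlong : t (k + 1) - t j ≤ 2 * δ
      · exact ⟨j, hnj, by omega, hlong, hSj⟩
      · have hαk := hαδ k hnk
        have htk := ht k
        refine ⟨k, hnk, by omega, by linarith, ?_⟩
        have h1 := hblock j k hnj hjk (by omega) htj
        have h2 : ‖S k - S n‖ ≤ ‖S k - S j‖ + ‖S j - S n‖ := norm_sub_le_norm_sub_add_norm_sub _ _ _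
        have h3 : 1 ≤ (t k - t j) / δ := by rw [le_div_iff₀ hδ]; linarith
        have h4 : (t k - t n) / δ = (t k - t j) / δ + (t j - t n) / δ := by ring
        rw [h4, add_mul]
        nlinarith
  obtain ⟨j, hnj, hjk, htj, hSj⟩ := key
  have h1 := hblock j k hnj hjk hk htj
  have h2 : ‖S k - S n‖ ≤ ‖S k - S j‖ + ‖S j - S n‖ := norm_sub_le_norm_sub_add_norm_sub _ _ _
  have h3 : (t j - t n) / δ * ν ≤ (t k - t n) / δ * ν := by
    have := hmono hjk
    gcongr
  linarith

theorem averages_along_slow_path [ProperSpace E]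
    (ht : ∀ i, t (i + 1) = t i + α i) (hα : ∀ i, 0 < α i)
    (hα0 : Tendsto α atTop (nhds 0))
    {l : Filter ℝ} {F : ℝ → ℕ → E → E} {g : E → E} {ℓ : ℕ → ℝ} {K : NNReal}
    (hF : ∀ c i p q, ‖F c i p - F c i q‖ ≤ ℓ i * ‖p - q‖) (hℓ : ∀ i, 0 ≤ ℓ i)
    (hg : LipschitzWith K g) (hℓavg : AveragesTo α t l (fun _ => ℓ) (K : ℝ))
    (havg : ∀ p, AveragesTo α t l (fun c i => F c i p) (g p))
    {T M ε : ℝ} (B : ℝ) (hT : 0 < T) (hM : 0 ≤ M) (hε : 0 < ε) :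
    ∀ᶠ N in atTop, ∀ᶠ c in l, ∀ n ≥ N, ∀ k₀ ≥ n, ∀ w : ℕ → E, t k₀ - t n ≤ T →
      (∀ i, n ≤ i → i ≤ k₀ → ‖w i‖ ≤ B) →
      (∀ i j, n ≤ i → i ≤ j → j ≤ k₀ → ‖w j - w i‖ ≤ M * (t j - t i)) →
      ‖∑ i ∈ Finset.Ico n k₀, α i • (F c i (w i) - g (w i))‖ ≤ ε := by
  have hmono := monotone_of_step ht hα
  set A : ℝ := 2 * M * (4 * K + 1) + 1 with hA
  have hA0 : 0 < A := by positivity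
  obtain ⟨δ, hδ, hδ1, hδε⟩ : ∃ δ : ℝ, 0 < δ ∧ δ ≤ 1 ∧ (T + 1) * A * δ ≤ ε := by
    refine ⟨min 1 (ε / ((T + 1) * A)), by positivity, min_le_left _ _, ?_⟩
    rw [← le_div_iff₀' (by positivity)]
    exact min_le_right _ _
  filter_upwards [averages_uniformly_on_compact ht hα hF hℓ hg hℓavg havg
      (isCompact_closedBall (0 : E) B) (by positivity : 0 < 2 * δ) (by positivity : 0 < δ ^ 2),
    hℓavg (2 * δ) (by positivity) δ hδ,
    eventually_forall_ge_atTop.2 (hα0.eventually_le_const hδ)] with N hN hN' hNα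
  filter_upwards [hN, hN'] with c hc hc' n hn k₀ hk₀ w hTk hwB hwM
  have hblock : ∀ j k, n ≤ j → j ≤ k → k ≤ k₀ → t k - t j ≤ 2 * δ →
      ‖∑ i ∈ Finset.range k, α i • (F c i (w i) - g (w i)) -
        ∑ i ∈ Finset.range j, α i • (F c i (w i) - g (w i))‖ ≤ A * δ ^ 2 := by
    intro j k hnj hjk hkk htk
    rw [← Finset.sum_Ico_eq_sub _ hjk]
    have hsum := sum_mul_le_of_norm_sum_smul_sub_le ht hjk (hc' j (hn.trans hnj) k hjk htk)
    have h1 := hc (w j) (by simpa using hwB j hnj (hjk.trans hkk)) j (hn.trans hnj) k hjk htk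
    have h2 : (K : ℝ) * (t k - t j) ≤ K * (2 * δ) := mul_le_mul_of_nonneg_left htk K.2
    refine (norm_sum_sub_le_of_near ht hα (hF c) hℓ hg hjk (w := w) (p := w j)
      (r := M * (2 * δ)) (fun i hi => ?_)).trans ?_
    · rw [Finset.mem_Ico] at hi
      refine (hwM j i hnj hi.1 (by omega)).trans (mul_le_mul_of_nonneg_left ?_ hM)
      linarith [hmono hi.2.le]
    · calc _ ≤ δ ^ 2 + (4 * (K * δ) + δ) * (M * (2 * δ)) :=
            add_le_add h1 (mul_le_mul_of_nonneg_right (by linarith) (by positivity))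
        _ = A * δ ^ 2 := by rw [hA]; ring
  have h1 := norm_sub_le_of_blocks ht hα hδ (by positivity) (fun i hi => hNα i (hn.trans hi))
    hblock hk₀ le_rfl
  rw [← Finset.sum_Ico_eq_sub _ hk₀] at h1
  refine h1.trans ?_
  calc ((t k₀ - t n) / δ + 1) * (A * δ ^ 2) ≤ (T / δ + 1) * (A * δ ^ 2) := by gcongr
    _ = (T + δ) * A * δ := by field_simp
    _ ≤ (T + 1) * A * δ := by gcongr
    _ ≤ ε := hδε

theorem discrete_gronwall_sum {u a : ℕ → ℝ} {ε : ℝ} {n k₀ : ℕ} (ha : ∀ i, 0 ≤ a i)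
    (hε : 0 ≤ ε)
    (hu : ∀ j, n ≤ j → j ≤ k₀ → u j ≤ ε + ∑ i ∈ Finset.Ico n j, a i * u i)
    {k : ℕ} (hnk : n ≤ k) (hk : k ≤ k₀) :
    u k ≤ ε * Real.exp (∑ i ∈ Finset.Ico n k, a i) := by
  refine (hu k hnk hk).trans ?_
  induction k, hnk using Nat.le_induction with
  | base => simp
  | succ k hnk ih =>
    have ih := ih (by omega)
    rw [Finset.sum_Ico_succ_top hnk, Finset.sum_Ico_succ_top hnk, Real.exp_add]
    have h1 := mul_le_mul_of_nonneg_left ((hu k hnk (by omega)).trans ih) (ha k)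
    have h2 := mul_le_mul_of_nonneg_left (Real.add_one_le_exp (a k))
      (mul_nonneg hε (Real.exp_pos (∑ i ∈ Finset.Ico n k, a i)).le)
    nlinarith

/-- Iterates started in a fixed ball shadow the solutions of the averaged equation on windows of
fixed length. -/
theorem iterates_shadow_solutions [ProperSpace E]
    (ht : ∀ i, t (i + 1) = t i + α i) (hα : ∀ i, 0 < α i)
    (hα0 : Tendsto α atTop (nhds 0))
    {l : Filter ℝ} {F : ℝ → ℕ → E → E} {g : E → E} {ℓ : ℕ → ℝ} {K : NNReal}
    (hF : ∀ c i p q, ‖F c i p - F c i q‖ ≤ ℓ i * ‖p - q‖) (hℓ : ∀ i, 0 ≤ ℓ i)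
    (hg : LipschitzWith K g) (hℓavg : AveragesTo α t l (fun _ => ℓ) (K : ℝ))
    (havg : ∀ p, AveragesTo α t l (fun c i => F c i p) (g p))
    {T ε : ℝ} (R : ℝ) (hT : 0 < T) (hε : 0 < ε) :
    ∀ᶠ N in atTop, ∀ᶠ c in l, ∀ n ≥ N, ∀ z : ℕ → E,
      (∀ i, z (i + 1) = z i + α i • F c i (z i)) → ‖z n‖ ≤ R →
      ∀ w : ℝ → E, (∀ s, HasDerivAt w (g (w s)) s) → w 0 = z n →
      ∀ j ≥ n, t j - t n ≤ T → ‖z j - w (t j - t n)‖ ≤ ε := by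
  have hmono := monotone_of_step ht hα
  obtain ⟨B, M, hM, hBM⟩ := exists_bounds_of_solution hg T R
  set η : ℝ := ε / Real.exp (K * T + 1) with hη
  have hη0 : 0 < η := by positivity
  obtain ⟨δ, hδ, hδη⟩ : ∃ δ : ℝ, 0 < δ ∧ K * M * T * δ ≤ η / 2 := by
    refine ⟨η / 2 / (K * M * T + 1), by positivity, ?_⟩
    rw [mul_div_assoc', div_le_iff₀ (by positivity)]
    nlinarith
  filter_upwards [averages_along_slow_path ht hα hα0 hF hℓ hg hℓavg havg B hT hM (half_pos hη0),
    hℓavg T hT 1 one_pos,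
    eventually_forall_ge_atTop.2 (hα0.eventually_le_const hδ)] with N hN hN' hNα
  filter_upwards [hN, hN'] with c hc hc' n hn z hz hzR w hw hw0 k₀ hk₀ hTk
  obtain ⟨hwB, hwM⟩ := hBM w hw (by rwa [hw0])
  have hmem : ∀ i, n ≤ i → i ≤ k₀ → t i - t n ∈ Set.Icc 0 T := fun i hni hik =>
    ⟨by linarith [hmono hni], by linarith [hmono hik]⟩
  have hwM' : ∀ i j, n ≤ i → i ≤ j → j ≤ k₀ →
      ‖w (t j - t n) - w (t i - t n)‖ ≤ M * (t j - t i) := fun i j hni hij hjk => by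
    have := hwM _ (hmem i hni (hij.trans hjk)) _ (hmem j (hni.trans hij) hjk)
    rwa [sub_sub_sub_cancel_right, abs_of_nonneg (by linarith [hmono hij])] at this
  have hint : ∀ j, n ≤ j → j ≤ k₀ → ‖z j - w (t j - t n)‖ ≤
      η + ∑ i ∈ Finset.Ico n j, (α i * ℓ i) * ‖z i - w (t i - t n)‖ := by
    intro j hnj hjk
    have hsplit : z j - w (t j - t n) =
        ∑ i ∈ Finset.Ico n j, α i • (F c i (w (t i - t n)) - g (w (t i - t n))) +
        -∑ i ∈ Finset.Ico n j,
          (w (t (i + 1) - t n) - w (t i - t n) - α i • g (w (t i - t n))) +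
        ∑ i ∈ Finset.Ico n j, α i • (F c i (z i) - F c i (w (t i - t n))) := by
      have h0 : z j - w (t j - t n) = ∑ i ∈ Finset.Ico n j,
          ((z (i + 1) - w (t (i + 1) - t n)) - (z i - w (t i - t n))) := by
        rw [Finset.sum_Ico_sub (fun i => z i - w (t i - t n)) hnj]
        simp [hw0]
      rw [h0, ← Finset.sum_neg_distrib, ← Finset.sum_add_distrib, ← Finset.sum_add_distrib]
      exact Finset.sum_congr rfl fun i _ => by rw [hz]; module
    have h1 := hc n hn j hnj (fun i => w (t i - t n)) (by linarith [hmono hjk])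
      (fun i hni hij => hwB _ (hmem i hni (hij.trans hjk)))
      (fun i i' hni hii' hij => hwM' i i' hni hii' (hij.trans hjk))
    have h2 : ‖-∑ i ∈ Finset.Ico n j,
        (w (t (i + 1) - t n) - w (t i - t n) - α i • g (w (t i - t n)))‖ ≤ η / 2 := by
      rw [norm_neg]
      have hstep : ∀ i ∈ Finset.Ico n j,
          ‖w (t (i + 1) - t n) - w (t i - t n) - α i • g (w (t i - t n))‖ ≤
            K * M * δ * α i := by
        intro i hi
        rw [Finset.mem_Ico] at hi
        have hsub : t (i + 1) - t n - (t i - t n) = α i := by rw [ht]; ring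
        have h3 := norm_solution_sub_euler_step_le hg hw hM
          (r := t i - t n) (s := t (i + 1) - t n) (by linarith [hα i]) (fun u hu =>
            hwM _ (hmem i hi.1 (by omega)) u
              ⟨(hmem i hi.1 (by omega)).1.trans hu.1,
                hu.2.trans (hmem (i + 1) (by omega) (by omega)).2⟩)
        rw [hsub] at h3
        refine h3.trans ?_
        have h4 : α i * α i ≤ δ * α i :=
          mul_le_mul_of_nonneg_right (hNα i (hn.trans hi.1)) (hα i).le
        have h5 : (0 : ℝ) ≤ K * M := by positivity
        nlinarith
      refine (norm_sum_le_of_le _ hstep).trans ?_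
      rw [← Finset.mul_sum, sum_Ico_step ht hnj]
      refine le_trans ?_ hδη
      have : t j - t n ≤ T := (hmem j hnj hjk).2
      calc (K : ℝ) * M * δ * (t j - t n) ≤ K * M * δ * T := by gcongr
        _ = K * M * T * δ := by ring
    have h3 : ‖∑ i ∈ Finset.Ico n j, α i • (F c i (z i) - F c i (w (t i - t n)))‖ ≤
        ∑ i ∈ Finset.Ico n j, (α i * ℓ i) * ‖z i - w (t i - t n)‖ := by
      refine norm_sum_le_of_le _ fun i _ => ?_
      rw [norm_smul, Real.norm_of_nonneg (hα i).le, mul_assoc]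
      exact mul_le_mul_of_nonneg_left (hF c i _ _) (hα i).le
    rw [hsplit]
    refine (norm_add₃_le).trans ?_
    linarith
  refine (discrete_gronwall_sum (u := fun i => ‖z i - w (t i - t n)‖)
    (fun i => mul_nonneg (hα i).le (hℓ i)) hη0.le hint hk₀ le_rfl).trans ?_
  have hsum := sum_mul_le_of_norm_sum_smul_sub_le ht hk₀ (hc' n hn k₀ hk₀ hTk)
  have h2 : (K : ℝ) * (t k₀ - t n) ≤ K * T := mul_le_mul_of_nonneg_left hTk K.2
  calc η * Real.exp (∑ i ∈ Finset.Ico n k₀, α i * ℓ i) ≤ η * Real.exp (K * T + 1) := by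
        gcongr
        linarith
    _ = ε := by rw [hη]; field_simp

end Averaging

section Stability

variable {E : Type*} [NormedAddCommGroup E] [NormedSpace ℝ E] {α t : ℕ → ℝ}

theorem exists_uniform_attraction_time [ProperSpace E] {g : E → E} {K : NNReal}
    (hg : LipschitzWith K g)
    (hattr : ∀ w : ℝ → E, (∀ s, HasDerivAt w (g (w s)) s) → Tendsto w atTop (nhds 0))
    {ε δ : ℝ} (hδ : 0 < δ)
    (hstab : ∀ w : ℝ → E, (∀ s, HasDerivAt w (g (w s)) s) → ‖w 0‖ ≤ δ →
      ∀ s, 0 ≤ s → ‖w s‖ ≤ ε) {S : Set E} (hS : IsCompact S) :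
    ∃ T : ℝ, 0 < T ∧ ∀ w : ℝ → E, (∀ s, HasDerivAt w (g (w s)) s) → w 0 ∈ S →
      ∀ s ≥ T, ‖w s‖ ≤ ε := by
  refine hS.induction_on (p := fun S => ∃ T : ℝ, 0 < T ∧ ∀ w : ℝ → E,
    (∀ s, HasDerivAt w (g (w s)) s) → w 0 ∈ S → ∀ s ≥ T, ‖w s‖ ≤ ε) ⟨1, by simp⟩ ?_ ?_ ?_
  · rintro s u hsu ⟨T, hT, hu⟩
    exact ⟨T, hT, fun w hw h0 => hu w hw (hsu h0)⟩
  · rintro s u ⟨T, hT, hs⟩ ⟨T', -, hu⟩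
    exact ⟨max T T', by positivity, fun w hw h0 r hr => h0.elim
      (fun h0 => hs w hw h0 r ((le_max_left _ _).trans hr))
      (fun h0 => hu w hw h0 r ((le_max_right _ _).trans hr))⟩
  · intro p _
    obtain ⟨z, hz0, hz⟩ := exists_global_solution_of_lipschitz hg p
    obtain ⟨T, hTz, hT⟩ := (((hattr z hz).norm.eventually_le_const
      (by simpa using half_pos hδ : ‖(0 : E)‖ < δ / 2)).and (eventually_gt_atTop 0)).exists
    refine ⟨Metric.closedBall p (δ / 2 / Real.exp (K * T)),
      mem_nhdsWithin_of_mem_nhds (Metric.closedBall_mem_nhds _ (by positivity)), T, hT,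
      fun w hw h0 s hs => ?_⟩
    have hclose := dist_solutions_le hg hw hz 0 T
    rw [mem_closedBall_iff_norm, le_div_iff₀ (Real.exp_pos _)] at h0
    rw [hz0, sub_zero, abs_of_pos hT] at hclose
    have hwT : ‖w T‖ ≤ δ := by
      have := norm_le_norm_sub_add (w T) (z T)
      linarith
    have := hstab (fun s => w (s + T)) (fun s => (hw (s + T)).comp_add_const s T)
      (by simpa using hwT) (s - T) (by linarith)
    simpa using this

theorem iterates_bounded_of_scaled_average [ProperSpace E]
    (ht : ∀ i, t (i + 1) = t i + α i) (hα : ∀ i, 0 < α i) (hα0 : Tendsto α atTop (nhds 0))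
    {G : ℕ → E → E} {g : E → E} {ℓ : ℕ → ℝ} {K : NNReal}
    (hG : ∀ i p q, ‖G i p - G i q‖ ≤ ℓ i * ‖p - q‖) (hℓ : ∀ i, 0 ≤ ℓ i)
    (hg : LipschitzWith K g) (hℓavg : AveragesTo α t atTop (fun _ => ℓ) (K : ℝ))
    (havg : ∀ p, AveragesTo α t atTop (fun c i => c⁻¹ • G i (c • p)) (g p))
    {T : ℝ} (hT : 0 < T)
    (hattr : ∀ w : ℝ → E, (∀ s, HasDerivAt w (g (w s)) s) → ‖w 0‖ ≤ 1 →
      ∀ s ≥ T, ‖w s‖ ≤ 1 / 2)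
    {x : ℕ → E} (hx : ∀ i, x (i + 1) = x i + α i • G i (x i)) :
    ∃ R, ∀ n, ‖x n‖ ≤ R := by
  obtain ⟨B, M, -, hB⟩ := exists_bounds_of_solution hg (T + 1) 1
  have hF : ∀ (c : ℝ) i p q, ‖c⁻¹ • G i (c • p) - c⁻¹ • G i (c • q)‖ ≤ ℓ i * ‖p - q‖ := by
    intro c i p q
    rcases eq_or_ne c 0 with rfl | hc
    · simpa using mul_nonneg (hℓ i) (norm_nonneg _)
    · have h1 := hG i (c • p) (c • q)
      rw [← smul_sub, norm_smul] at h1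
      have hc' : 0 < ‖c‖ := norm_pos_iff.2 hc
      rw [← smul_sub, norm_smul, norm_inv, inv_mul_le_iff₀ hc']
      linarith
  obtain ⟨N, hN, hNα⟩ := ((iterates_shadow_solutions ht hα hα0 hF hℓ hg hℓavg havg
    1 (by linarith : 0 < T + 1) one_half_pos).and
    (eventually_forall_ge_atTop.2 (hα0.eventually_le_const one_pos))).exists
  obtain ⟨c, hc, hxN, hc1⟩ := (hN.and ((eventually_ge_atTop ‖x N‖).and
    (eventually_ge_atTop 1))).exists
  have hc0 : 0 < c := by linarith
  have hz : ∀ i, c⁻¹ • x (i + 1) = c⁻¹ • x i + α i • c⁻¹ • G i (c • c⁻¹ • x i) := fun i => by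
    rw [hx, smul_inv_smul₀ hc0.ne', smul_add, smul_comm]
  have hnorm : ∀ i a, ‖c⁻¹ • x i‖ ≤ a ↔ ‖x i‖ ≤ c * a := fun i a => by
    rw [norm_smul, norm_inv, Real.norm_of_nonneg hc0.le, inv_mul_le_iff₀ hc0]
  have hwin : ∀ n ≥ N, ‖x n‖ ≤ c → ∀ j ≥ n, t j - t n ≤ T + 1 →
      ‖x j‖ ≤ c * (B + 1 / 2) ∧ (T ≤ t j - t n → ‖x j‖ ≤ c) := by
    intro n hn hxn j hj htj
    obtain ⟨w, hw0, hw⟩ := exists_global_solution_of_lipschitz hg (c⁻¹ • x n)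
    have hzn : ‖c⁻¹ • x n‖ ≤ 1 := by rw [hnorm]; linarith
    have hshadow := hc n hn (fun i => c⁻¹ • x i) hz hzn w hw hw0 j hj htj
    have hwn : ‖w 0‖ ≤ 1 := by rwa [hw0]
    have htri := norm_le_norm_sub_add (c⁻¹ • x j) (w (t j - t n))
    constructor
    · rw [← hnorm]
      have := (hB w hw hwn).1 (t j - t n)
        ⟨by linarith [monotone_of_step ht hα hj], htj⟩
      linarith
    · intro hTj
      rw [← mul_one c, ← hnorm]
      have := hattr w hw hwn _ hTj
      linarith
  have hchain : ∀ i ≥ N, ∃ n ≥ N, n ≤ i ∧ t i - t n ≤ T + 1 ∧ ‖x n‖ ≤ c := by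
    intro i hi
    induction i, hi using Nat.le_induction with
    | base => exact ⟨N, le_rfl, le_rfl, by linarith, hxN⟩
    | succ i hi ih =>
      obtain ⟨n, hn, hni, hti, hxn⟩ := ih
      have hstep := ht i
      have hαi := hNα i hi
      by_cases hlong : t (i + 1) - t n ≤ T + 1
      · exact ⟨n, hn, by omega, hlong, hxn⟩
      · exact ⟨i, hi, by omega, by linarith, (hwin n hn hxn i hni hti).2 (by linarith)⟩
  obtain ⟨R, hR⟩ := ((Finset.range N).image fun n => ‖x n‖).bddAbove
  refine ⟨max R (c * (B + 1 / 2)), fun n => ?_⟩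
  rcases lt_or_ge n N with hn | hn
  · exact le_max_of_le_left (hR (by simpa using ⟨n, hn, rfl⟩))
  · obtain ⟨k, hk, hkn, htk, hxk⟩ := hchain n hn
    exact le_max_of_le_right (hwin k hk hxk n hkn htk).1

theorem exists_index_of_tendsto_atTop (htop : Tendsto t atTop atTop) {N : ℕ} {s : ℝ}
    (hs : t N ≤ s) : ∃ j ≥ N, t j ≤ s ∧ s < t (j + 1) := by
  by_contra! hcon
  have hle : ∀ j ≥ N, t j ≤ s := fun j hj => by
    induction j, hj using Nat.le_induction with
    | base => exact hs
    | succ j hj ih => exact hcon j hj ih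
  obtain ⟨j, hj, hsj⟩ := ((eventually_ge_atTop N).and (htop.eventually_gt_atTop s)).exists
  exact absurd (hle j hj) (not_le.2 hsj)

theorem mapClusterPt_solution [ProperSpace E]
    (ht : ∀ i, t (i + 1) = t i + α i) (hα : ∀ i, 0 < α i) (hα0 : Tendsto α atTop (nhds 0))
    (htop : Tendsto t atTop atTop)
    {G : ℕ → E → E} {g : E → E} {ℓ : ℕ → ℝ} {K : NNReal}
    (hG : ∀ i p q, ‖G i p - G i q‖ ≤ ℓ i * ‖p - q‖) (hℓ : ∀ i, 0 ≤ ℓ i)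
    (hg : LipschitzWith K g) (hℓavg : AveragesTo α t (pure 1) (fun _ => ℓ) (K : ℝ))
    (havg : ∀ p, AveragesTo α t (pure 1) (fun _ i => G i p) (g p))
    {x : ℕ → E} (hx : ∀ i, x (i + 1) = x i + α i • G i (x i)) {R : ℝ} (hR : ∀ n, ‖x n‖ ≤ R)
    {z : ℝ → E} (hz : ∀ s, HasDerivAt z (g (z s)) s) (hz0 : MapClusterPt (z 0) atTop x) (s : ℝ) :
    MapClusterPt (z s) atTop x := by
  have hmono := monotone_of_step ht hα
  have hclose : ∀ δ > 0, ∀ N, ∃ n ≥ N, ‖x n - z 0‖ ≤ δ := fun δ hδ N => by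
    obtain ⟨n, hn, hnδ⟩ := (mapClusterPt_iff_frequently.1 hz0 _
      (Metric.closedBall_mem_nhds _ hδ)).forall_exists_of_atTop N
    exact ⟨n, hn, mem_closedBall_iff_norm.1 hnδ⟩
  rw [Metric.nhds_basis_closedBall.mapClusterPt_iff_frequently]
  intro ε hε
  rw [frequently_atTop]
  intro N₀
  set Λ : ℝ := Real.exp (K * (|s| + 1)) with hΛ
  have hΛ0 : 0 < Λ := Real.exp_pos _
  have hΛ1 : 1 ≤ Λ := Real.one_le_exp (by positivity)
  have hexp : ∀ r, |r| ≤ |s| + 1 → Real.exp (K * |r|) ≤ Λ := fun r hr =>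
    Real.exp_le_exp.2 (mul_le_mul_of_nonneg_left hr K.2)
  set η : ℝ := ε / (3 * Λ) with hη
  have hη0 : 0 < η := by positivity
  have hηΛ : η * Λ = ε / 3 := by rw [hη]; field_simp
  have hηle : η ≤ ε / 3 := by nlinarith
  obtain ⟨ρ, hρ, hzρ⟩ := Metric.continuousAt_iff.1 (hz s).continuousAt (ε / 3) (by positivity)
  obtain ⟨N, ⟨hN, hNα⟩, hNN₀⟩ := (((iterates_shadow_solutions ht hα hα0
    (F := fun _ i p => G i p) (fun _ => hG) hℓ hg hℓavg havg
    R (by positivity : 0 < |s| + 1) hη0).and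
    (eventually_forall_ge_atTop.2 (hα0.eventually_lt_const (lt_min one_pos hρ)))).and
    (eventually_ge_atTop N₀)).exists
  rw [eventually_pure] at hN
  rcases le_total 0 s with hs | hs
  · obtain ⟨n, hn, hxn⟩ := hclose η hη0 N
    obtain ⟨j, hj, htj, hjt⟩ := exists_index_of_tendsto_atTop htop
      (N := n) (s := t n + s) (by linarith)
    refine ⟨j, by omega, ?_⟩
    obtain ⟨w, hw0, hw⟩ := exists_global_solution_of_lipschitz hg (x n)
    have hαj := lt_min_iff.1 (hNα j (by omega))
    rw [ht] at hjt
    rw [abs_of_nonneg hs] at hexp hN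
    have h0 : 0 ≤ t j - t n := by linarith [hmono hj]
    have h1 := hN n hn x hx (hR n) w hw hw0 j hj (by linarith)
    have h2 := dist_solutions_le hg hw hz 0 (t j - t n)
    have h3 : dist (z (t j - t n)) (z s) < ε / 3 := hzρ (by
      rw [Real.dist_eq, abs_lt]; constructor <;> linarith)
    have h4 : ‖w (t j - t n) - z (t j - t n)‖ ≤ η * Λ := h2.trans (by
      rw [hw0, sub_zero]
      gcongr
      exact hexp _ (by rw [abs_of_nonneg h0]; linarith))
    rw [mem_closedBall_iff_norm]
    rw [dist_eq_norm] at h3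
    have h5 := norm_sub_le_norm_sub_add_norm_sub (x j) (w (t j - t n)) (z s)
    have h6 := norm_sub_le_norm_sub_add_norm_sub (w (t j - t n)) (z (t j - t n)) (z s)
    linarith
  · obtain ⟨N₁, hN₁⟩ := (eventually_atTop.1 (htop.eventually_ge_atTop (t N - s)))
    obtain ⟨n, hn, hxn⟩ := hclose η hη0 N₁
    obtain ⟨j, hj, htj, hjt⟩ := exists_index_of_tendsto_atTop htop
      (N := N) (s := t n + s) (by linarith [hN₁ n hn])
    refine ⟨j, by omega, ?_⟩
    obtain ⟨w, hw0, hw⟩ := exists_global_solution_of_lipschitz hg (x j)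
    have hαj := lt_min_iff.1 (hNα j hj)
    rw [ht] at hjt
    rw [abs_of_nonpos hs] at hexp hN
    have hjn : j ≤ n := by
      by_contra! hlt
      have := hmono hlt
      rw [Nat.succ_eq_add_one, ht] at this
      have := hmono hlt.le
      linarith [hα n]
    have h0 : 0 ≤ t n - t j := by linarith
    have h1 := hN j hj x hx (hR j) w hw hw0 n hjn (by linarith)
    have h2 := dist_solutions_le hg hw
      (fun u => (hz (u - (t n - t j))).comp_sub_const u (t n - t j)) (t n - t j) 0
    have h3 : dist (z (0 - (t n - t j))) (z s) < ε / 3 := hzρ (by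
      rw [Real.dist_eq, abs_lt]; constructor <;> linarith)
    have h4 := norm_sub_le_norm_sub_add_norm_sub (w (t n - t j)) (x n) (z 0)
    have h5 : ‖x j - z (0 - (t n - t j))‖ ≤ (η + η) * Λ := by
      rw [hw0, sub_self (t n - t j)] at h2
      rw [norm_sub_rev] at h1
      refine h2.trans ?_
      gcongr
      · linarith
      · exact hexp _ (by rw [zero_sub, abs_neg, abs_of_nonneg h0]; linarith)
    rw [mem_closedBall_iff_norm]
    rw [dist_eq_norm] at h3
    have h6 := norm_sub_le_norm_sub_add_norm_sub (x j) (z (0 - (t n - t j))) (z s)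
    linarith

end Stability

section LimitSet

variable {E : Type*} [NormedAddCommGroup E] [NormedSpace ℝ E] {α t : ℕ → ℝ}

theorem averagesTo_pure_iff {F : ℕ → E} {v : E} :
    AveragesTo α t (pure 1) (fun _ => F) v ↔ ∀ τ > 0, ∀ ε > 0, ∀ᶠ N in atTop, ∀ n ≥ N, ∀ k ≥ n,
      t k - t n ≤ τ → ‖∑ i ∈ Finset.Ico n k, α i • (F i - v)‖ ≤ ε := by
  simp only [AveragesTo, eventually_pure]

theorem AveragesTo.of_pure {F : ℕ → E} {v : E} (h : AveragesTo α t (pure 1) (fun _ => F) v)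
    (l : Filter ℝ) : AveragesTo α t l (fun _ => F) v := fun τ hτ ε hε =>
  (averagesTo_pure_iff.1 h τ hτ ε hε).mono fun _ hN => .of_forall fun _ => hN

theorem AveragesTo.const_smul {F : ℕ → E} {v : E} (h : AveragesTo α t (pure 1) (fun _ => F) v)
    (a : ℝ) : AveragesTo α t (pure 1) (fun _ i => a • F i) (a • v) := by
  rw [averagesTo_pure_iff] at h ⊢
  intro τ hτ ε hε
  filter_upwards [h τ hτ (ε / (|a| + 1)) (by positivity)] with N hN n hn k hk hnk
  have heq : ∑ i ∈ Finset.Ico n k, α i • (a • F i - a • v) =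
      a • ∑ i ∈ Finset.Ico n k, α i • (F i - v) := by
    rw [Finset.smul_sum]
    exact Finset.sum_congr rfl fun i _ => by module
  rw [heq, norm_smul, Real.norm_eq_abs]
  have h1 := hN n hn k hk hnk
  rw [le_div_iff₀ (by positivity)] at h1
  nlinarith [norm_nonneg (∑ i ∈ Finset.Ico n k, α i • (F i - v))]

theorem exists_bound_sum_of_averages (ht : ∀ i, t (i + 1) = t i + α i) (hα : ∀ i, 0 < α i)
    {D : ℝ → ℕ → E} {β : ℕ → E} {κ : ℝ → ℝ} {v : ℝ → E}
    (hD : ∀ c ≥ 1, ∀ c' ≥ 1, ∀ i, D c i - D c' i = (κ c - κ c') • β i)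
    (havg : ∀ c ≥ 1, AveragesTo α t (pure 1) (fun _ => D c) (v c)) {τ : ℝ} (hτ : 0 < τ) :
    ∃ M, 0 ≤ M ∧ ∀ᶠ N in atTop, ∀ n ≥ N, ∀ k ≥ n, t k - t n ≤ τ → ∀ c ≥ 1, ∀ c' ≥ 1,
      ‖(κ c - κ c') • ∑ i ∈ Finset.Ico n k, α i • β i‖ ≤ |κ c - κ c'| * M := by
  by_cases hconst : ∀ c ≥ 1, ∀ c' ≥ 1, κ c = κ c'
  · refine ⟨0, le_rfl, .of_forall fun N n _ k _ _ c hc c' hc' => ?_⟩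
    simp [hconst c hc c' hc']
  · push Not at hconst
    obtain ⟨c₁, hc₁, c₂, hc₂, hne⟩ := hconst
    have hd : 0 < |κ c₁ - κ c₂| := abs_pos.2 (sub_ne_zero.2 hne)
    refine ⟨(1 + 1 + τ * ‖v c₁ - v c₂‖) / |κ c₁ - κ c₂|, by positivity, ?_⟩
    filter_upwards [averagesTo_pure_iff.1 (havg c₁ hc₁) τ hτ 1 one_pos,
      averagesTo_pure_iff.1 (havg c₂ hc₂) τ hτ 1 one_pos] with N h₁ h₂ n hn k hk hnk c _ c' _
    rw [norm_smul, Real.norm_eq_abs]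
    refine mul_le_mul_of_nonneg_left ?_ (abs_nonneg _)
    rw [le_div_iff₀' hd, ← Real.norm_eq_abs (κ c₁ - κ c₂), ← norm_smul]
    have hsplit : (κ c₁ - κ c₂) • ∑ i ∈ Finset.Ico n k, α i • β i =
        ∑ i ∈ Finset.Ico n k, α i • (D c₁ i - v c₁) +
        -∑ i ∈ Finset.Ico n k, α i • (D c₂ i - v c₂) + (t k - t n) • (v c₁ - v c₂) := by
      rw [← sum_Ico_step ht hk, Finset.sum_smul, ← Finset.sum_neg_distrib,
        ← Finset.sum_add_distrib, ← Finset.sum_add_distrib, Finset.smul_sum]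
      refine Finset.sum_congr rfl fun i _ => ?_
      rw [smul_comm, ← hD c₁ hc₁ c₂ hc₂]
      module
    rw [hsplit]
    refine norm_add₃_le.trans (add_le_add (add_le_add (h₁ n hn k hk hnk) ?_) ?_)
    · rw [norm_neg]
      exact h₂ n hn k hk hnk
    · rw [norm_smul, Real.norm_of_nonneg (sub_nonneg.2 (monotone_of_step ht hα hk))]
      gcongr

/-- If the members of a family differ by multiples of one sequence and each has an average, then
the averaging is uniform at infinity, towards the limit of the averages. -/
theorem averagesTo_atTop_of_family (ht : ∀ i, t (i + 1) = t i + α i) (hα : ∀ i, 0 < α i)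
    {D : ℝ → ℕ → E} {β : ℕ → E} {κ : ℝ → ℝ} {v : ℝ → E} {v' : E}
    (hκ : Tendsto κ atTop (nhds 0))
    (hD : ∀ c ≥ 1, ∀ c' ≥ 1, ∀ i, D c i - D c' i = (κ c - κ c') • β i)
    (havg : ∀ c ≥ 1, AveragesTo α t (pure 1) (fun _ => D c) (v c))
    (hv : Tendsto v atTop (nhds v')) : AveragesTo α t atTop D v' := by
  intro τ hτ ε hε
  obtain ⟨M, hM, hbound⟩ := exists_bound_sum_of_averages ht hα hD havg hτ
  set ρ : ℝ := ε / (6 * (M + 1)) with hρ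
  have hρ0 : 0 < ρ := by positivity
  have hρM : 2 * ρ * M ≤ ε / 3 := by
    have : 2 * ρ * (M + 1) = ε / 3 := by rw [hρ]; field_simp; ring
    nlinarith
  have hκρ : ∀ᶠ c in atTop, |κ c| ≤ ρ :=
    (by simpa using hκ.abs : Tendsto (fun c => |κ c|) atTop (nhds 0)).eventually_le_const hρ0
  obtain ⟨c₀, hc₀κ, hc₀, hc₀v⟩ := (hκρ.and ((eventually_ge_atTop 1).and
    ((tendsto_iff_norm_sub_tendsto_zero.1 hv).eventually_le_const
      (by positivity : 0 < ε / 3 / τ)))).exists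
  filter_upwards [averagesTo_pure_iff.1 (havg c₀ hc₀) τ hτ (ε / 3) (by positivity), hbound]
    with N hN hN'
  filter_upwards [hκρ, eventually_ge_atTop 1] with c hcκ hc n hn k hk hnk
  have hsplit : ∑ i ∈ Finset.Ico n k, α i • (D c i - v') =
      ∑ i ∈ Finset.Ico n k, α i • (D c₀ i - v c₀) + (t k - t n) • (v c₀ - v') +
        (κ c - κ c₀) • ∑ i ∈ Finset.Ico n k, α i • β i := by
    rw [← sum_Ico_step ht hk, Finset.sum_smul, ← Finset.sum_add_distrib, Finset.smul_sum,
      ← Finset.sum_add_distrib]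
    refine Finset.sum_congr rfl fun i _ => ?_
    rw [smul_comm (κ c - κ c₀), ← hD c hc c₀ hc₀]
    module
  have h1 : ‖(t k - t n) • (v c₀ - v')‖ ≤ ε / 3 := by
    rw [norm_smul, Real.norm_of_nonneg (sub_nonneg.2 (monotone_of_step ht hα hk))]
    calc (t k - t n) * ‖v c₀ - v'‖ ≤ τ * (ε / 3 / τ) := by gcongr
      _ = ε / 3 := by field_simp
  have h2 : ‖(κ c - κ c₀) • ∑ i ∈ Finset.Ico n k, α i • β i‖ ≤ ε / 3 := by
    refine (hN' n hn k hk hnk c hc c₀ hc₀).trans (le_trans ?_ hρM)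
    have : |κ c - κ c₀| ≤ 2 * ρ := (abs_sub _ _).trans (by linarith)
    gcongr
  rw [hsplit]
  refine norm_add₃_le.trans ?_
  linarith [hN n hn k hk hnk]

theorem tendsto_infDist_mapClusterPt {V : Type*} [PseudoMetricSpace V] {S : Set V}
    (hS : IsCompact S) {x : ℕ → V} (hx : ∀ n, x n ∈ S) :
    Tendsto (fun n => Metric.infDist (x n) {p | MapClusterPt p atTop x}) atTop (nhds 0) := by
  refine tendsto_order.2 ⟨fun a ha => .of_forall fun n => ha.trans_le Metric.infDist_nonneg,
    fun ε hε => ?_⟩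
  by_contra hcon
  have hfreq : ∃ᶠ n in atTop,
      x n ∈ S ∩ {q | ε ≤ Metric.infDist q {p | MapClusterPt p atTop x}} :=
    (not_eventually.1 hcon).mono fun n hn => ⟨hx n, not_lt.1 hn⟩
  have hclosed : IsClosed {q | ε ≤ Metric.infDist q {p | MapClusterPt p atTop x}} :=
    isClosed_le continuous_const (Metric.continuous_infDist_pt _)
  obtain ⟨q, hq, hqx⟩ := (hS.inter_right hclosed).exists_mapClusterPt_of_frequently hfreq
  have hq_far : ε ≤ Metric.infDist q {p | MapClusterPt p atTop x} := hq.2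
  have hq_mem : q ∈ {p | MapClusterPt p atTop x} := hqx
  linarith [Metric.infDist_zero_of_mem hq_mem]

end LimitSet

theorem convergence_to_bounded_invariant_set
    {E : Type*} [NormedAddCommGroup E] [NormedSpace ℝ E] [FiniteDimensional ℝ E]
    [Nontrivial E]
    {𝓨 : Type*}
    (α : ℕ → ℝ)
    (hα_pos : ∀ n, 0 < α n)
    (hα_anti : ∀ n, α (n + 1) ≤ α n)
    (hα_div : Tendsto (fun n => ∑ i ∈ Finset.range n, α i) atTop atTop)
    (hα_to0 : Tendsto α atTop (nhds 0))
    (Cα : ℝ) (hCα_pos : 0 < Cα)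
    (hCα : ∀ n, α n - α (n + 1) ≤ Cα * α n ^ 2)
    (t : ℕ → ℝ) (ht : ∀ n, t n = ∑ i ∈ Finset.range n, α i)
    (m : ℝ → ℕ)
    (hm_le : ∀ s : ℝ, 0 ≤ s → t (m s) ≤ s)
    (hm_max : ∀ s : ℝ, 0 ≤ s → ∀ i : ℕ, t i ≤ s → i ≤ m s)
    (hm_neg : ∀ s : ℝ, s < 0 → m s = 0)
    (Y : ℕ → 𝓨) (H : E → 𝓨 → E)
    (x : ℕ → E)
    (hx : ∀ n, x (n + 1) = x n + α n • H (x n) (Y (n + 1)))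
    (L : 𝓨 → ℝ) (hL_nonneg : ∀ y, 0 ≤ L y)
    (hH_lip : ∀ x₁ x₂ : E, ∀ y : 𝓨, ‖H x₁ y - H x₂ y‖ ≤ L y * ‖x₁ - x₂‖)
    (Hinf : E → 𝓨 → E) (κ : ℝ → ℝ) (hκ : Tendsto κ atTop (nhds 0))
    (b : E → 𝓨 → E) (Lb : 𝓨 → ℝ) (hLb_nonneg : ∀ y, 0 ≤ Lb y)
    (hHc : ∀ c : ℝ, 1 ≤ c → ∀ x' : E, ∀ y : 𝓨,
      c⁻¹ • H (c • x') y - Hinf x' y = κ c • b x' y)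
    (hb_lip : ∀ x₁ x₂ : E, ∀ y : 𝓨, ‖b x₁ y - b x₂ y‖ ≤ Lb y * ‖x₁ - x₂‖)
    (hHinf_lip : ∀ x₁ x₂ : E, ∀ y : 𝓨, ‖Hinf x₁ y - Hinf x₂ y‖ ≤ L y * ‖x₁ - x₂‖)
    (h : E → E) (Lbar : ℝ) (hLbar : 0 ≤ Lbar)
    (Lbbar : ℝ) (hLbbar : 0 ≤ Lbbar)
    (hrateH : ∀ τ : ℝ, 0 < τ → ∀ x' : E, ∀ ε : ℝ, 0 < ε → ∃ N : ℕ, ∀ n ≥ N,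
      ∀ t₁ t₂ : ℝ, -τ ≤ t₁ → t₁ ≤ t₂ → t₂ ≤ τ →
        ‖∑ i ∈ Finset.Ico (m (t n + t₁)) (m (t n + t₂)),
            α i • (H x' (Y (i + 1)) - h x')‖ ≤ ε)
    (hrateLb : ∀ τ : ℝ, 0 < τ → ∀ ε : ℝ, 0 < ε → ∃ N : ℕ, ∀ n ≥ N,
      ∀ t₁ t₂ : ℝ, -τ ≤ t₁ → t₁ ≤ t₂ → t₂ ≤ τ →
        |∑ i ∈ Finset.Ico (m (t n + t₁)) (m (t n + t₂)),
            α i * (Lb (Y (i + 1)) - Lbbar)| ≤ ε)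
    (hrateL : ∀ τ : ℝ, 0 < τ → ∀ ε : ℝ, 0 < ε → ∃ N : ℕ, ∀ n ≥ N,
      ∀ t₁ t₂ : ℝ, -τ ≤ t₁ → t₁ ≤ t₂ → t₂ ≤ τ →
        |∑ i ∈ Finset.Ico (m (t n + t₁)) (m (t n + t₂)),
            α i * (L (Y (i + 1)) - Lbar)| ≤ ε)
    (hh_lip : ∀ x₁ x₂ : E, ‖h x₁ - h x₂‖ ≤ Lbar * ‖x₁ - x₂‖)
    (hinf : E → E)
    (hhinf_lip : ∀ x₁ x₂ : E, ‖hinf x₁ - hinf x₂‖ ≤ Lbar * ‖x₁ - x₂‖)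
    (hunif : ∀ K : Set E, IsCompact K →
      TendstoUniformlyOn (fun (c : ℝ) (x' : E) => c⁻¹ • h (c • x')) hinf atTop K)
    (hinf0 : hinf 0 = 0)
    (hglobal : ∀ z : ℝ → E, ContinuousOn z (Set.Ici 0) →
      (∀ s : ℝ, 0 ≤ s → z s = z 0 + ∫ u in (0:ℝ)..s, hinf (z u)) →
      Tendsto z atTop (nhds 0))
    (hstable : ∀ ε : ℝ, 0 < ε → ∃ δ : ℝ, 0 < δ ∧ ∀ z : ℝ → E,
      ContinuousOn z (Set.Ici 0) →
      (∀ s : ℝ, 0 ≤ s → z s = z 0 + ∫ u in (0:ℝ)..s, hinf (z u)) →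
      ‖z 0‖ ≤ δ → ∀ s : ℝ, 0 ≤ s → ‖z s‖ ≤ ε)
 :
    ∃ X : Set E, X.Nonempty ∧ Bornology.IsBounded X ∧
      (∀ p ∈ X, ∃ z : ℝ → E, Continuous z ∧
        (∀ s : ℝ, z s = z 0 + ∫ u in (0:ℝ)..s, h (z u)) ∧
        z 0 = p ∧ (∀ s : ℝ, z s ∈ X)) ∧
      Tendsto (fun n => Metric.infDist (x n) X) atTop (nhds 0) := by
  have : ProperSpace E := FiniteDimensional.proper_real E
  have hstep : ∀ i, t (i + 1) = t i + α i := fun i => by rw [ht, ht, Finset.sum_range_succ]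
  have htop : Tendsto t atTop atTop := hα_div.congr fun n => (ht n).symm
  have hmono : StrictMono t := strictMono_nat_of_lt_succ fun i => by
    rw [hstep]; linarith [hα_pos i]
  have ht0 : ∀ i, 0 ≤ t i := fun i => by
    rw [ht]; exact Finset.sum_nonneg fun i _ => (hα_pos i).le
  have hmt : ∀ i, m (t i) = i := fun i =>
    le_antisymm (hmono.le_iff_le.1 (hm_le _ (ht0 i))) (hm_max _ (ht0 i) i le_rfl)
  have hwindow : ∀ {τ : ℝ} {n k : ℕ}, n ≤ k → t k - t n ≤ τ → -τ ≤ 0 ∧ 0 ≤ t k - t n ∧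
      m (t n + 0) = n ∧ m (t n + (t k - t n)) = k := fun {τ n k} hnk hτ => by
    have := hmono.monotone hnk
    exact ⟨by linarith, by linarith, by rw [add_zero, hmt], by rw [add_sub_cancel, hmt]⟩
  lift Lbar to NNReal using hLbar
  have hhL : LipschitzWith Lbar h := .of_dist_le_mul fun p q => by
    simpa [dist_eq_norm] using hh_lip p q
  have hinfL : LipschitzWith Lbar hinf := .of_dist_le_mul fun p q => by
    simpa [dist_eq_norm] using hhinf_lip p q
  have havg : ∀ p, AveragesTo α t (pure 1) (fun _ i => H p (Y (i + 1))) (h p) := fun p => by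
    rw [averagesTo_pure_iff]
    intro τ hτ ε hε
    obtain ⟨N, hN⟩ := hrateH τ hτ p ε hε
    refine eventually_atTop.2 ⟨N, fun N' hN' n hn k hk hnk => ?_⟩
    obtain ⟨h1, h2, h3, h4⟩ := hwindow hk hnk
    simpa only [h3, h4] using hN n (hN'.trans hn) 0 (t k - t n) h1 h2 hnk
  have hLavg : AveragesTo α t (pure 1) (fun _ i => L (Y (i + 1))) (Lbar : ℝ) := by
    rw [averagesTo_pure_iff]
    intro τ hτ ε hε
    obtain ⟨N, hN⟩ := hrateL τ hτ ε hε
    refine eventually_atTop.2 ⟨N, fun N' hN' n hn k hk hnk => ?_⟩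
    obtain ⟨h1, h2, h3, h4⟩ := hwindow hk hnk
    simpa only [h3, h4, smul_eq_mul, Real.norm_eq_abs] using hN n (hN'.trans hn) 0 (t k - t n) h1 h2 hnk
  have havg_inf : ∀ p, AveragesTo α t atTop
      (fun c i => c⁻¹ • H (c • p) (Y (i + 1))) (hinf p) := fun p =>
    averagesTo_atTop_of_family hstep hα_pos (β := fun i => b p (Y (i + 1)))
      (v := fun c => c⁻¹ • h (c • p)) hκ
      (fun c hc c' hc' i => by
        rw [sub_smul, ← hHc c hc, ← hHc c' hc', sub_sub_sub_cancel_right])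
      (fun c _ => (havg (c • p)).const_smul c⁻¹)
      ((hunif {p} isCompact_singleton).tendsto_at rfl)
  have hcont : ∀ {f : E → E} {z : ℝ → E}, (∀ s, HasDerivAt z (f (z s)) s) → Continuous z :=
    fun hz => continuous_iff_continuousAt.2 fun s => (hz s).continuousAt
  obtain ⟨δ, hδ, hδstab⟩ := hstable (1 / 2) one_half_pos
  obtain ⟨T, hT, hattr⟩ := exists_uniform_attraction_time hinfL
    (fun w hw => hglobal w (hcont hw).continuousOn
      fun s _ => integral_eq_of_hasDerivAt hinfL.continuous hw s) hδ
    (fun w hw => hδstab w (hcont hw).continuousOn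
      fun s _ => integral_eq_of_hasDerivAt hinfL.continuous hw s)
    (isCompact_closedBall (0 : E) 1)
  obtain ⟨R, hR⟩ := iterates_bounded_of_scaled_average hstep hα_pos hα_to0
    (G := fun i p => H p (Y (i + 1))) (fun i p q => hH_lip p q _) (fun i => hL_nonneg _) hinfL
    (hLavg.of_pure atTop) havg_inf hT (fun w hw h0 => hattr w hw (by simpa using h0)) hx
  have hball : ∀ n, x n ∈ Metric.closedBall (0 : E) R := fun n => by simpa using hR n
  have hcompact := isCompact_closedBall (0 : E) R
  refine ⟨{p | MapClusterPt p atTop x}, ?_, hcompact.isBounded.subset fun p hp => ?_,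
    fun p hp => ?_, tendsto_infDist_mapClusterPt hcompact hball⟩
  · obtain ⟨p, -, hp⟩ := hcompact.exists_mapClusterPt_of_frequently
      (Frequently.of_forall (f := atTop) hball)
    exact ⟨p, hp⟩
  · exact Metric.isClosed_closedBall.mem_of_mapClusterPt hp (.of_forall hball)
  · obtain ⟨z, hz0, hz⟩ := exists_global_solution_of_lipschitz hhL p
    exact ⟨z, hcont hz, integral_eq_of_hasDerivAt hhL.continuous hz, hz0,
      mapClusterPt_solution hstep hα_pos hα_to0 htop (G := fun i p => H p (Y (i + 1)))
        (fun i p q => hH_lip p q _) (fun i => hL_nonneg _) hhL hLavg havg hx hR hz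
        (by rwa [hz0])⟩
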